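/- arXiv:1804.05952 — 3 statements merged into one kernel-verified Lean document; each statement's English description precedes it below -/
import Mathlib

section
/- For every odd integer k ≥ 5 and every integer m ≥ k, B(m,k) ≥ ((k−1)/2)·(m−k+6) − 3. -/
open Set

/-- A point in the plane. -/
abbrev Pt : Type := ℝ × ℝ

/-- The point set `P` contains an `n`-up-run: `n` points with strictly increasing
`x`-coordinates and nondecreasing `y`-coordinates. -/
def HasUpRun (P : Set Pt) (n : ℕ) : Prop :=
  ∃ f : Fin n → Pt, (∀ i, f i ∈ P) ∧
    StrictMono (fun i => (f i).1) ∧ Monotone (fun i => (f i).2)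

/-- The point set `P` contains an `n`-down-run: `n` points with strictly increasing
`x`-coordinates and strictly decreasing `y`-coordinates. -/
def HasDownRun (P : Set Pt) (n : ℕ) : Prop :=
  ∃ f : Fin n → Pt, (∀ i, f i ∈ P) ∧
    StrictMono (fun i => (f i).1) ∧ StrictAnti (fun i => (f i).2)

/-- A strategy for player A: from the list of previously played points, choose
an x-coordinate. -/
abbrev AStrat : Type := List Pt → ℝ

/-- A strategy for player B: from the list of previously played points and the new
x-coordinate, choose a y-coordinate. -/
abbrev BStrat : Type := List Pt → ℝ → ℝ

/-- Validity of a strategy for player A in either game: the chosen x-coordinate lies in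
`(0,1)` and is distinct from all previously played x-coordinates. -/
def AValid (sA : AStrat) : Prop :=
  ∀ h : List Pt, sA h ∈ Ioo (0:ℝ) 1 ∧ ∀ p ∈ h, sA h ≠ p.1

/-- Validity of a strategy for player B in the game `A_{m,k}`: the chosen y-coordinate
lies in `(0,1)` and is distinct from all previously played y-coordinates. -/
def BValid (sB : BStrat) : Prop :=
  ∀ (h : List Pt) (x : ℝ), sB h x ∈ Ioo (0:ℝ) 1 ∧ ∀ p ∈ h, sB h x ≠ p.2

/-- The list of points played in the first `n` turns when A plays `sA` and B plays `sB`. -/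
def hist (sA : AStrat) (sB : BStrat) : ℕ → List Pt
  | 0 => []
  | n + 1 =>
      let h := hist sA sB n
      h ++ [(sA h, sB h (sA h))]

/-- The set of points played in the first `N` turns. -/
def played (sA : AStrat) (sB : BStrat) (N : ℕ) : Set Pt :=
  {p | p ∈ hist sA sB N}

/-- In the game `A_{m,k}`, strategy `sA` of player A is valid and guarantees an
`m`-up-run or a `k`-down-run among the first `N` points, against every valid
strategy of player B. -/
def AWinsBy (m k N : ℕ) (sA : AStrat) : Prop :=
  AValid sA ∧ ∀ sB : BStrat, BValid sB →
    HasUpRun (played sA sB N) m ∨ HasDownRun (played sA sB N) k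

/-- The Erdős–Szekeres on-line number `ESO(m,k)`: the least `N` such that player A
has a strategy forcing an `m`-up-run or a `k`-down-run within `N` turns. -/
noncomputable def ESO (m k : ℕ) : ℕ := sInf {N | ∃ sA : AStrat, AWinsBy m k N sA}

/-- Validity of a strategy for player B in the tier game `B_{m,k}`: the chosen
y-coordinate is an integer in `{1, …, k-1}` (repetitions allowed). -/
def BTierValid (k : ℕ) (sB : BStrat) : Prop :=
  ∀ (h : List Pt) (x : ℝ), ∃ j : ℕ, 1 ≤ j ∧ j ≤ k - 1 ∧ sB h x = (j : ℝ)

/-- In the tier game `B_{m,k}`, strategy `sA` of player A is valid and guarantees an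
`m`-up-run among the first `N` points, against every valid strategy of player B. -/
def AWinsTierBy (m k N : ℕ) (sA : AStrat) : Prop :=
  AValid sA ∧ ∀ sB : BStrat, BTierValid k sB → HasUpRun (played sA sB N) m

/-- `B(m,k)`: the least `N` such that player A has a strategy forcing an `m`-up-run
within `N` turns of the tier game `B_{m,k}`. -/
noncomputable def BNum (m k : ℕ) : ℕ := sInf {N | ∃ sA : AStrat, AWinsTierBy m k N sA}

theorem exists_aValid : ∃ sA : AStrat, AValid sA := by
  have h : ∀ h : List Pt, ∃ x : ℝ, x ∈ Ioo (0 : ℝ) 1 ∧ ∀ p ∈ h, x ≠ p.1 := by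
    intro h
    obtain ⟨x, hx, hxh⟩ := (Ioo_infinite (zero_lt_one' ℝ)).exists_notMem_finset
      (h.map Prod.fst).toFinset
    refine ⟨x, hx, fun p hp hxp => hxh ?_⟩
    simp only [List.mem_toFinset, List.mem_map]
    exact ⟨p, hp, hxp.symm⟩
  choose sA hsA using h
  exact ⟨sA, hsA⟩

theorem hist_length (sA : AStrat) (sB : BStrat) (n : ℕ) : (hist sA sB n).length = n := by
  induction n with
  | zero => rfl
  | succ n ih => simp [hist, ih]

theorem hist_nodup_fst {sA : AStrat} (hA : AValid sA) (sB : BStrat) (n : ℕ) :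
    ((hist sA sB n).map Prod.fst).Nodup := by
  induction n with
  | zero => simp [hist]
  | succ n ih =>
    simp only [hist, List.map_append, List.map_cons, List.map_nil]
    refine List.Nodup.append ih (List.nodup_singleton _) ?_
    simp only [List.disjoint_singleton, List.mem_map, not_exists, not_and]
    exact fun p hp h => (hA (hist sA sB n)).2 p hp h.symm

theorem hist_tier {k : ℕ} (sA : AStrat) {sB : BStrat} (hB : BTierValid k sB) (n : ℕ) :
    ∀ p ∈ hist sA sB n, p.2 ∈ (Finset.Icc 1 (k - 1)).image (Nat.cast : ℕ → ℝ) := by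
  induction n with
  | zero => simp [hist]
  | succ n ih =>
    intro p hp
    simp only [hist, List.mem_append, List.mem_singleton] at hp
    rcases hp with hp | rfl
    · exact ih p hp
    · obtain ⟨j, h1, h2, h3⟩ := hB (hist sA sB n) (sA (hist sA sB n))
      exact Finset.mem_image.2 ⟨j, Finset.mem_Icc.2 ⟨h1, h2⟩, h3.symm⟩

theorem played_mono (sA : AStrat) (sB : BStrat) : Monotone (played sA sB) := by
  refine monotone_nat_of_le_succ fun n p hp => ?_
  simp only [played, hist, Set.mem_ofPred_eq, List.mem_append] at hp ⊢
  exact Or.inl hp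

/-- Any valid strategy of A eventually wins the tier game, by the pigeonhole principle. -/
theorem exists_aWinsTierBy (m k : ℕ) : {N | ∃ sA : AStrat, AWinsTierBy m k N sA}.Nonempty := by
  obtain ⟨sA, hA⟩ := exists_aValid
  refine ⟨(k - 1) * m + 1, sA, hA, fun sB hB => ?_⟩
  set H := hist sA sB ((k - 1) * m + 1) with hH
  have hnd : (H.map Prod.fst).Nodup := hist_nodup_fst hA sB _
  have hcard : H.toFinset.card = (k - 1) * m + 1 := by
    rw [List.toFinset_card_of_nodup (List.Nodup.of_map _ hnd), hH, hist_length]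
  obtain ⟨y, -, hy⟩ := Finset.exists_lt_card_fiber_of_mul_lt_card_of_maps_to
    (s := H.toFinset) (t := (Finset.Icc 1 (k - 1)).image (Nat.cast : ℕ → ℝ)) (f := Prod.snd)
    (n := m) (fun p hp => hist_tier sA hB _ p (List.mem_toFinset.1 hp)) (by
      rw [hcard]
      have := Finset.card_image_le (s := Finset.Icc 1 (k - 1)) (f := (Nat.cast : ℕ → ℝ))
      rw [Nat.card_Icc, Nat.add_sub_cancel] at this
      have := Nat.mul_le_mul_right m this
      omega)
  set F := H.toFinset.filter (fun p => p.2 = y) with hF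
  have hinj : Set.InjOn Prod.fst (F : Set Pt) := by
    intro p hp q hq hpq
    simp only [hF, Finset.coe_filter, Set.mem_ofPred_eq] at hp hq
    exact Prod.ext hpq (hp.2.trans hq.2.symm)
  have hcF : m ≤ (F.image Prod.fst).card := by
    rw [Finset.card_image_of_injOn hinj]; exact hy.le
  refine ⟨fun i => (Finset.orderEmbOfCardLe _ hcF i, y), fun i => ?_,
    (Finset.orderEmbOfCardLe _ hcF).strictMono, monotone_const⟩
  beta_reduce
  obtain ⟨p, hp, hpe⟩ := Finset.mem_image.1 (Finset.orderEmbOfCardLe_mem _ hcF i)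
  simp only [hF, Finset.mem_filter, List.mem_toFinset] at hp
  have hpe' : (Finset.orderEmbOfCardLe _ hcF i, y) = p := Prod.ext hpe.symm hp.2.symm
  rw [hpe']
  exact hp.1

/-- From the position `S` (a finite set of points with natural tiers), player B has a way to
play `n` further turns in tiers `1, …, k - 1` without creating an `m`-up-run. -/
def Survives (m k : ℕ) : ℕ → Finset (ℝ × ℕ) → Prop
  | 0, S => ¬ ∃ f : Fin m → ℝ × ℕ, (∀ i, f i ∈ S) ∧
      StrictMono (fun i => (f i).1) ∧ Monotone (fun i => (f i).2)
  | n + 1, S => ∀ x : ℝ, (∀ p ∈ S, p.1 ≠ x) →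
      ∃ j : ℕ, 1 ≤ j ∧ j ≤ k - 1 ∧ Survives m k n (insert (x, j) S)

/-- The tier position described by a list of points. -/
noncomputable def tierPos (h : List Pt) : Finset (ℝ × ℕ) :=
  (h.map fun p => (p.1, ⌊p.2⌋₊)).toFinset

theorem tierPos_append (h : List Pt) (x : ℝ) (j : ℕ) :
    tierPos (h ++ [(x, (j : ℝ))]) = insert (x, j) (tierPos h) := by
  ext p
  simp only [tierPos, List.map_append, List.map_cons, List.map_nil, Nat.floor_natCast,
    List.mem_toFinset, List.mem_append, List.mem_singleton, Finset.mem_insert]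
  exact or_comm

theorem exists_hist_survives {m k L : ℕ} (hk : 2 ≤ k) (hL : Survives m k L ∅) {sA : AStrat}
    (hA : AValid sA) : ∃ sB : BStrat, BTierValid k sB ∧
      ∀ i ≤ L, Survives m k (L - i) (tierPos (hist sA sB i)) := by
  classical
  let good (h : List Pt) (x : ℝ) (j : ℕ) : Prop :=
    1 ≤ j ∧ j ≤ k - 1 ∧ Survives m k (L - (h.length + 1)) (insert (x, j) (tierPos h))
  let sB : BStrat := fun h x =>
    if hg : ∃ j, good h x j then ((Classical.choose hg : ℕ) : ℝ) else ((1 : ℕ) : ℝ)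
  have hsB (h x) (hg : ∃ j, good h x j) : ∃ j, good h x j ∧ sB h x = (j : ℝ) :=
    ⟨_, Classical.choose_spec hg, dif_pos hg⟩
  refine ⟨sB, fun h x => ?_, fun i => ?_⟩
  · by_cases hg : ∃ j, good h x j
    · obtain ⟨j, hj, hj'⟩ := hsB h x hg
      exact ⟨j, hj.1, hj.2.1, hj'⟩
    · exact ⟨1, le_rfl, by omega, dif_neg hg⟩
  · induction i with
    | zero => exact fun _ => hL
    | succ i ih =>
      intro hi
      have ih := ih (by omega)
      rw [show L - i = L - (i + 1) + 1 by omega] at ih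
      set h := hist sA sB i with hh
      have hx : ∀ p ∈ tierPos h, p.1 ≠ sA h := by
        intro p hp
        simp only [tierPos, List.mem_toFinset, List.mem_map] at hp
        obtain ⟨q, hq, rfl⟩ := hp
        exact ((hA h).2 q hq).symm
      have hg : ∃ j, good h (sA h) j := by
        obtain ⟨j, h1, h2, h3⟩ := ih _ hx
        refine ⟨j, h1, h2, ?_⟩
        rw [hh, hist_length]
        exact h3
      obtain ⟨j, hj, hj'⟩ := hsB h (sA h) hg
      have h3 := hj.2.2
      rw [hh, hist_length, ← hh, ← tierPos_append, ← hj'] at h3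
      exact h3

/-- If B survives `L` turns from the empty position, then `B(m,k) > L`. -/
theorem lt_BNum_of_survives {m k L : ℕ} (hk : 2 ≤ k) (hL : Survives m k L ∅) :
    L < BNum m k := by
  refine Nat.lt_of_succ_le (le_csInf (exists_aWinsTierBy m k) ?_)
  rintro N ⟨sA, hA, hN⟩
  by_contra! hlt
  obtain ⟨sB, hB, hs⟩ := exists_hist_survives hk hL hA
  obtain ⟨f, hf, hf1, hf2⟩ := hN sB hB
  have h0 := hs L le_rfl
  rw [Nat.sub_self] at h0
  refine h0 ⟨fun i => ((f i).1, ⌊(f i).2⌋₊), fun i => ?_, hf1,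
    fun i j hij => Nat.floor_mono (hf2 hij)⟩
  simp only [tierPos, List.mem_toFinset, List.mem_map]
  exact ⟨f i, played_mono sA sB (by omega) (hf i), rfl⟩

/-- B survives if some invariant can be maintained up to a position of size `L` from which
B survives. -/
theorem survives_of_invariant {m k L l : ℕ} (I : Finset (ℝ × ℕ) → Prop)
    (step : ∀ S, I S → S.card < L → ∀ x, (∀ p ∈ S, p.1 ≠ x) →
      ∃ j : ℕ, 1 ≤ j ∧ j ≤ k - 1 ∧ I (insert (x, j) S))
    (fin : ∀ S, I S → S.card = L → Survives m k l S) (n : ℕ) :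
    ∀ S, I S → S.card + n = L → Survives m k (n + l) S := by
  induction n with
  | zero => intro S hS h; rw [Nat.zero_add]; exact fin S hS h
  | succ n ih =>
    intro S hS h
    rw [Nat.add_right_comm]
    intro x hx
    obtain ⟨j, h1, h2, h3⟩ := step S hS (by omega) x hx
    refine ⟨j, h1, h2, ih _ h3 ?_⟩
    rw [Finset.card_insert_of_notMem fun hm => hx _ hm rfl]
    omega

/-- A function strictly increasing along up-runs with values in an interval bounds their
length. -/
theorem survives_zero_of_potential {m k lo hi : ℕ} {S : Finset (ℝ × ℕ)} (φ : ℝ × ℕ → ℕ)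
    (hm : hi + 1 - lo < m) (hφ : ∀ p ∈ S, lo ≤ φ p ∧ φ p ≤ hi)
    (hlt : ∀ p ∈ S, ∀ q ∈ S, p.1 < q.1 → p.2 ≤ q.2 → φ p < φ q) : Survives m k 0 S := by
  rintro ⟨f, hf, hf1, hf2⟩
  have hmono : StrictMono fun i => φ (f i) := fun i j hij =>
    hlt _ (hf i) _ (hf j) (hf1 hij) (hf2 hij.le)
  have := Finset.card_le_card_of_injOn (s := Finset.univ) (t := Finset.Icc lo hi)
    (fun i => φ (f i)) (fun i _ => Finset.mem_coe.2 (Finset.mem_Icc.2 (hφ _ (hf i))))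
    hmono.injective.injOn
  rw [Finset.card_univ, Fintype.card_fin, Nat.card_Icc] at this
  omega

/-- Starting from a position `S₀` whose tiers lie strictly between `1` and `n`, player B can
survive `D` more turns by playing in tiers `1` and `n` only, given suitable bounds `a`, `b` on
the number of points of tier `1` to the left and of tier `n` to the right of each place. -/
theorem survives_outer {m k n D lo hi : ℕ} {S₀ : Finset (ℝ × ℕ)} (a b : ℝ → ℕ) (ψ : ℝ × ℕ → ℕ)
    (hn : 2 ≤ n) (hnk : n ≤ k - 1) (hS₀ : ∀ p ∈ S₀, 1 < p.2 ∧ p.2 < n)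
    (ha : Monotone a) (hb : Antitone b)
    (hD : ∀ x, (∀ p ∈ S₀, p.1 ≠ x) → D ≤ a x + b x) (hm : hi + 1 - lo < m)
    (hab : ∀ x, lo + a x + b x ≤ hi + 1)
    (hψa : ∀ p ∈ S₀, lo + a p.1 ≤ ψ p) (hψb : ∀ p ∈ S₀, ψ p + b p.1 ≤ hi)
    (hψ : ∀ p ∈ S₀, ∀ q ∈ S₀, p.1 < q.1 → p.2 ≤ q.2 → ψ p < ψ q) :
    Survives m k D S₀ := by
  let cl (S : Finset (ℝ × ℕ)) (z : ℝ) : ℕ := (S.filter fun p => p.2 = 1 ∧ p.1 ≤ z).card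
  let cr (S : Finset (ℝ × ℕ)) (z : ℝ) : ℕ := (S.filter fun p => p.2 = n ∧ z ≤ p.1).card
  have hins (S : Finset (ℝ × ℕ)) (x : ℝ) (j : ℕ) (hx : ∀ p ∈ S, p.1 ≠ x) : (x, j) ∉ S :=
    fun h => hx _ h rfl
  have hcl (S : Finset (ℝ × ℕ)) (x z : ℝ) (hx : ∀ p ∈ S, p.1 ≠ x) :
      cl (insert (x, 1) S) z = cl S z + if x ≤ z then 1 else 0 := by
    simp only [cl, Finset.filter_insert, true_and]
    split_ifs
    · rw [Finset.card_insert_of_notMem fun h => hins S x 1 hx (Finset.mem_of_mem_filter _ h)]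
    · rfl
  have hcl' (S : Finset (ℝ × ℕ)) (x z : ℝ) : cl (insert (x, n) S) z = cl S z := by
    simp only [cl, Finset.filter_insert]
    rw [if_neg (by omega)]
  have hcr (S : Finset (ℝ × ℕ)) (x z : ℝ) (hx : ∀ p ∈ S, p.1 ≠ x) :
      cr (insert (x, n) S) z = cr S z + if z ≤ x then 1 else 0 := by
    simp only [cr, Finset.filter_insert, true_and]
    split_ifs
    · rw [Finset.card_insert_of_notMem fun h => hins S x n hx (Finset.mem_of_mem_filter _ h)]
    · rfl
  have hcr' (S : Finset (ℝ × ℕ)) (x z : ℝ) : cr (insert (x, 1) S) z = cr S z := by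
    simp only [cr, Finset.filter_insert]
    rw [if_neg (by omega)]
  have hcard (S : Finset (ℝ × ℕ)) (hsub : S₀ ⊆ S) (x y : ℝ) :
      S₀.card + cl S x + cr S y ≤ S.card := by
    rw [← Finset.card_union_of_disjoint, ← Finset.card_union_of_disjoint]
    · refine Finset.card_le_card (Finset.union_subset (Finset.union_subset hsub ?_) ?_) <;>
      exact Finset.filter_subset _ _
    · rw [Finset.disjoint_union_left, Finset.disjoint_left, Finset.disjoint_left]
      refine ⟨fun p hp hp' => ?_, fun p hp hp' => ?_⟩
      · have := hS₀ p hp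
        have := (Finset.mem_filter.1 hp').2.1
        omega
      · have := (Finset.mem_filter.1 hp).2.1
        have := (Finset.mem_filter.1 hp').2.1
        omega
    · rw [Finset.disjoint_left]
      intro p hp hp'
      have := hS₀ p hp
      have := (Finset.mem_filter.1 hp').2.1
      omega
  refine survives_of_invariant (L := S₀.card + D) (l := 0)
    (fun S => S₀ ⊆ S ∧ (∀ p ∈ S, p ∈ S₀ ∨ p.2 = 1 ∨ p.2 = n) ∧
      (∀ z, cl S z ≤ a z) ∧ (∀ z, cr S z ≤ b z)) ?_ ?_ D S₀ ?_ rfl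
  · rintro S ⟨hsub, hmem, hl, hr⟩ hlt x hx
    by_cases h1 : ∀ z, cl (insert (x, 1) S) z ≤ a z
    · refine ⟨1, le_rfl, by omega, hsub.trans (Finset.subset_insert _ _), ?_, h1, ?_⟩
      · intro p hp
        rcases Finset.mem_insert.1 hp with rfl | hp
        · exact Or.inr (Or.inl rfl)
        · exact hmem p hp
      · intro z
        rw [hcr']
        exact hr z
    by_cases h2 : ∀ z, cr (insert (x, n) S) z ≤ b z
    · refine ⟨n, by omega, hnk, hsub.trans (Finset.subset_insert _ _), ?_, ?_, h2⟩
      · intro p hp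
        rcases Finset.mem_insert.1 hp with rfl | hp
        · exact Or.inr (Or.inr rfl)
        · exact hmem p hp
      · intro z
        rw [hcl']
        exact hl z
    push Not at h1 h2
    obtain ⟨z, hz⟩ := h1
    obtain ⟨w, hw⟩ := h2
    rw [hcl S x z hx] at hz
    rw [hcr S x w hx] at hw
    have := hl z
    have := hr w
    have hxz : x ≤ z := by by_contra h; rw [if_neg h] at hz; omega
    have hwx : w ≤ x := by by_contra h; rw [if_neg h] at hw; omega
    rw [if_pos hxz] at hz
    rw [if_pos hwx] at hw
    have := ha hxz
    have := hb hwx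
    have := hcard S hsub z w
    have := hD x fun p hp => hx p (hsub hp)
    omega
  · rintro S ⟨hsub, hmem, hl, hr⟩ -
    have hl' : ∀ p ∈ S, p.2 = 1 → (S.filter fun q => q.2 = 1 ∧ q.1 < p.1).card + 1 ≤ a p.1 := by
      intro p hp h
      refine le_trans (Nat.succ_le_of_lt (Finset.card_lt_card ?_)) (hl p.1)
      refine Finset.ssubset_iff_of_subset ?_ |>.2 ⟨p, by simp [hp, h], by simp⟩
      intro q
      simp only [Finset.mem_filter]
      exact fun hq => ⟨hq.1, hq.2.1, hq.2.2.le⟩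
    have hr' : ∀ p ∈ S, p.2 = n → (S.filter fun q => q.2 = n ∧ p.1 < q.1).card + 1 ≤ b p.1 := by
      intro p hp h
      refine le_trans (Nat.succ_le_of_lt (Finset.card_lt_card ?_)) (hr p.1)
      refine Finset.ssubset_iff_of_subset ?_ |>.2 ⟨p, by simp [hp, h], by simp⟩
      intro q
      simp only [Finset.mem_filter]
      exact fun hq => ⟨hq.1, hq.2.1, hq.2.2.le⟩
    have hll : ∀ p ∈ S, ∀ z, p.2 = 1 → p.1 < z →
        (S.filter fun q => q.2 = 1 ∧ q.1 < p.1).card <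
          (S.filter fun q => q.2 = 1 ∧ q.1 < z).card := by
      intro p hp z h hz
      refine Finset.card_lt_card ?_
      refine Finset.ssubset_iff_of_subset ?_ |>.2 ⟨p, by simp [hp, h, hz], by simp⟩
      intro q
      simp only [Finset.mem_filter]
      exact fun hq => ⟨hq.1, hq.2.1, hq.2.2.trans hz⟩
    have hrr : ∀ p ∈ S, ∀ z, p.2 = n → z < p.1 →
        (S.filter fun q => q.2 = n ∧ p.1 < q.1).card <
          (S.filter fun q => q.2 = n ∧ z < q.1).card := by
      intro p hp z h hz
      refine Finset.card_lt_card ?_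
      refine Finset.ssubset_iff_of_subset ?_ |>.2 ⟨p, by simp [hp, h, hz], by simp⟩
      intro q
      simp only [Finset.mem_filter]
      exact fun hq => ⟨hq.1, hq.2.1, hz.trans hq.2.2⟩
    let φ : ℝ × ℕ → ℕ := fun p =>
      if p.2 = 1 then lo + (S.filter fun q => q.2 = 1 ∧ q.1 < p.1).card
      else if p.2 = n then hi - (S.filter fun q => q.2 = n ∧ p.1 < q.1).card
      else ψ p
    have hφ1 (p : ℝ × ℕ) (h : p.2 = 1) :
        φ p = lo + (S.filter fun q => q.2 = 1 ∧ q.1 < p.1).card := if_pos h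
    have hφn (p : ℝ × ℕ) (h : p.2 = n) :
        φ p = hi - (S.filter fun q => q.2 = n ∧ p.1 < q.1).card := by
      simp only [φ]
      rw [if_neg (by omega), if_pos h]
    have hφ0 (p : ℝ × ℕ) (h : p ∈ S₀) : φ p = ψ p := by
      have := hS₀ p h
      simp only [φ]
      rw [if_neg (by omega), if_neg (by omega)]
    refine survives_zero_of_potential (lo := lo) (hi := hi) φ hm ?_ ?_
    · intro p hp
      have := hab p.1
      rcases hmem p hp with h | h | h
      · have := hψa p h
        have := hψb p h
        rw [hφ0 p h]
        omega
      · have := hl' p hp h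
        rw [hφ1 p h]
        omega
      · have := hr' p hp h
        rw [hφn p h]
        omega
    · intro p hp q hq hlt hle
      have hap := ha hlt.le
      have hbp := hb hlt.le
      have := hab p.1
      have := hab q.1
      rcases hmem p hp with h | h | h <;> rcases hmem q hq with h' | h' | h'
      · rw [hφ0 p h, hφ0 q h']
        exact hψ p h q h' hlt hle
      · have := hS₀ p h
        omega
      · have := hr' q hq h'
        have := hψb p h
        rw [hφ0 p h, hφn q h']
        omega
      · have := hl' p hp h
        have := hψa q h'
        rw [hφ1 p h, hφ0 q h']
        omega
      · have := hll p hp q.1 h hlt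
        rw [hφ1 p h, hφ1 q h']
        omega
      · have := hl' p hp h
        have := hr' q hq h'
        rw [hφ1 p h, hφn q h']
        omega
      · have := hS₀ q h'
        omega
      · omega
      · have := hrr q hq p.1 h' hlt
        have := hr' p hp h
        rw [hφn p h, hφn q h']
        omega
  · refine ⟨subset_rfl, fun p hp => Or.inl hp, fun z => ?_, fun z => ?_⟩
    · have : cl S₀ z = 0 := by
        refine Finset.card_eq_zero.2 (Finset.filter_eq_empty_iff.2 fun p hp h => ?_)
        have := hS₀ p hp
        omega
      omega
    · have : cr S₀ z = 0 := by
        refine Finset.card_eq_zero.2 (Finset.filter_eq_empty_iff.2 fun p hp h => ?_)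
        have := hS₀ p hp
        omega
      omega

/-- With three tiers available, B survives `2 * M` turns without an `(M + 1)`-up-run. -/
theorem survives_three_tiers {k M : ℕ} (hk : 4 ≤ k) (hM : 1 ≤ M) :
    Survives (M + 1) k (M + M) ∅ := by
  refine survives_of_invariant (L := M) (l := M)
    (fun S => (∀ p ∈ S, p.2 = 2)) ?_ ?_ M ∅ (by simp) (by simp)
  · intro S hS hlt x hx
    refine ⟨2, by omega, by omega, ?_⟩
    intro p hp
    rcases Finset.mem_insert.1 hp with rfl | hp
    · rfl
    · exact hS p hp
  · intro S hS hc
    have hsplit (x : ℝ) : (S.filter fun p => p.1 < x).card +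
        (S.filter fun p => x < p.1).card ≤ M := by
      rw [← Finset.card_union_of_disjoint, ← hc]
      · exact Finset.card_le_card
          (Finset.union_subset (Finset.filter_subset _ _) (Finset.filter_subset _ _))
      · refine Finset.disjoint_filter.2 fun p _ h => h.le.not_gt
    have hlt : ∀ p ∈ S, (S.filter fun q => q.1 < p.1).card + 1 +
        (S.filter fun q => p.1 < q.1).card ≤ M := by
      intro p hp
      rw [← hc, ← Finset.card_insert_of_notMem (a := p) (by simp),
        ← Finset.card_union_of_disjoint]
      · exact Finset.card_le_card (Finset.union_subset
          (Finset.insert_subset hp (Finset.filter_subset _ _)) (Finset.filter_subset _ _))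
      · rw [Finset.disjoint_left]
        intro q hq hq'
        have h2 := (Finset.mem_filter.1 hq').2
        rcases Finset.mem_insert.1 hq with rfl | hq
        · exact lt_irrefl _ h2
        · exact h2.not_gt (Finset.mem_filter.1 hq).2
    refine survives_outer (n := 3) (lo := 1) (hi := M)
      (fun x => (S.filter fun p => p.1 < x).card) (fun x => (S.filter fun p => x < p.1).card)
      (fun p => 1 + (S.filter fun q => q.1 < p.1).card) (by omega) (by omega) ?_ ?_ ?_ ?_
      (by omega) ?_ ?_ ?_ ?_
    · intro p hp
      rw [hS p hp]
      omega
    · intro x y hxy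
      exact Finset.card_le_card (Finset.monotone_filter_right _ fun p _ h => lt_of_lt_of_le h hxy)
    · intro x y hxy
      exact Finset.card_le_card (Finset.monotone_filter_right _ fun p _ h => lt_of_le_of_lt hxy h)
    · intro x hx
      rw [← hc, ← Finset.card_union_of_disjoint]
      · refine Finset.card_le_card fun p hp => ?_
        rcases lt_or_gt_of_ne (hx p hp) with h | h
        · exact Finset.mem_union_left _ (Finset.mem_filter.2 ⟨hp, h⟩)
        · exact Finset.mem_union_right _ (Finset.mem_filter.2 ⟨hp, h⟩)
      · exact Finset.disjoint_filter.2 fun p _ h => h.le.not_gt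
    · intro x
      have := hsplit x
      omega
    · intro p hp
      exact le_rfl
    · intro p hp
      have := hlt p hp
      omega
    · intro p hp q hq hpq _
      refine Nat.add_lt_add_left (Finset.card_lt_card ?_) 1
      refine Finset.ssubset_iff_of_subset ?_ |>.2 ⟨p, by simp [hp, hpq], by simp⟩
      intro r
      simp only [Finset.mem_filter]
      exact fun hr => ⟨hr.1, hr.2.trans hpq⟩

/-- The number of pivots in `P` to the left of `y`, which is the index of the cell of `y`. -/
noncomputable def cellIdx (P : Finset ℝ) (y : ℝ) : ℕ := (P.filter fun p => p < y).card

/-- The points of `S` lying in the `i`-th cell determined by the pivots `P`. -/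
noncomputable def cell (S : Finset (ℝ × ℕ)) (P : Finset ℝ) (i : ℕ) : Finset (ℝ × ℕ) :=
  S.filter fun p => cellIdx P p.1 = i

/-- The number of tiers excluded in the `i`-th of the cells `0, …, q`. -/
def cellLoss (q i : ℕ) : ℕ := (if i = 0 then 1 else 0) + if i = q then 1 else 0

theorem cellIdx_mono (P : Finset ℝ) : Monotone (cellIdx P) := fun _ _ h =>
  Finset.card_le_card (Finset.monotone_filter_right _ fun _ _ hp => lt_of_lt_of_le hp h)

theorem cellIdx_le (P : Finset ℝ) (y : ℝ) : cellIdx P y ≤ P.card := Finset.card_filter_le _ _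

theorem cellIdx_lt_of_mem {P : Finset ℝ} {v y : ℝ} (hv : v ∈ P) (h : v < y) :
    cellIdx P v < cellIdx P y := by
  refine Finset.card_lt_card (Finset.ssubset_iff_of_subset ?_ |>.2 ⟨v, by simp [hv, h], by simp⟩)
  intro r
  simp only [Finset.mem_filter]
  exact fun hr => ⟨hr.1, hr.2.trans h⟩

theorem cellIdx_insert {P : Finset ℝ} {v : ℝ} (hv : v ∉ P) (y : ℝ) :
    cellIdx (insert v P) y = cellIdx P y + if v < y then 1 else 0 := by
  simp only [cellIdx, Finset.filter_insert]
  split_ifs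
  · rw [Finset.card_insert_of_notMem fun h => hv (Finset.mem_of_mem_filter _ h)]
  · rfl

theorem mem_cell {S : Finset (ℝ × ℕ)} {P : Finset ℝ} {i : ℕ} {p : ℝ × ℕ} :
    p ∈ cell S P i ↔ p ∈ S ∧ cellIdx P p.1 = i := Finset.mem_filter

theorem cell_insert_self (S : Finset (ℝ × ℕ)) {P : Finset ℝ} {v : ℝ} (hv : v ∉ P) :
    cell S (insert v P) (cellIdx P v) = (cell S P (cellIdx P v)).filter fun p => p.1 ≤ v := by
  ext p
  rw [Finset.mem_filter, mem_cell, mem_cell, cellIdx_insert hv, and_assoc]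
  refine and_congr_right fun _ => ?_
  rcases le_or_gt p.1 v with h | h
  · simp [h, h.not_gt]
  · have := cellIdx_mono P h.le
    simp only [h, h.not_ge, if_true, and_false, iff_false]
    omega

theorem cell_insert_self_add_one (S : Finset (ℝ × ℕ)) {P : Finset ℝ} {v : ℝ}
    (hv : v ∉ P) :
    cell S (insert v P) (cellIdx P v + 1) = (cell S P (cellIdx P v)).filter fun p => v < p.1 := by
  ext p
  rw [Finset.mem_filter, mem_cell, mem_cell, cellIdx_insert hv, and_assoc]
  refine and_congr_right fun _ => ?_
  rcases le_or_gt p.1 v with h | h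
  · have := cellIdx_mono P h
    simp only [h.not_gt, if_false, and_false, iff_false]
    omega
  · simp [h]

theorem cell_insert_of_lt (S : Finset (ℝ × ℕ)) {P : Finset ℝ} {v : ℝ} (hv : v ∉ P)
    {j : ℕ} (hj : j < cellIdx P v) :
    cell S (insert v P) j = cell S P j := by
  ext p
  rw [mem_cell, mem_cell, cellIdx_insert hv]
  refine and_congr_right fun _ => ?_
  rcases le_or_gt p.1 v with h | h
  · simp [h.not_gt]
  · have := cellIdx_mono P h.le
    rw [if_pos h]
    omega

theorem cell_insert_of_gt (S : Finset (ℝ × ℕ)) {P : Finset ℝ} {v : ℝ} (hv : v ∉ P)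
    {j : ℕ} (hj : cellIdx P v < j) :
    cell S (insert v P) (j + 1) = cell S P j := by
  ext p
  rw [mem_cell, mem_cell, cellIdx_insert hv]
  refine and_congr_right fun _ => ?_
  rcases le_or_gt p.1 v with h | h
  · have := cellIdx_mono P h
    rw [if_neg h.not_gt]
    omega
  · simp [h]

/-- The invariant of the inner phase: tiers lie in `2, …, 2 * s`, points of a common cell have
distinct tiers, and the extreme tiers are not used in the extreme cells. -/
structure CellInv (s : ℕ) (S : Finset (ℝ × ℕ)) (P : Finset ℝ) : Prop where
  inj : Set.InjOn Prod.fst (S : Set (ℝ × ℕ))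
  tier : ∀ p ∈ S, 2 ≤ p.2 ∧ p.2 ≤ 2 * s
  distinct : ∀ p ∈ S, ∀ q ∈ S, cellIdx P p.1 = cellIdx P q.1 → p.2 = q.2 → p = q
  first : ∀ p ∈ S, cellIdx P p.1 = 0 → p.2 ≠ 2
  last : ∀ p ∈ S, cellIdx P p.1 = P.card → p.2 ≠ 2 * s

/-- The tiers that may be used in the `i`-th of the cells `0, …, q`. -/
def allowedTiers (s q i : ℕ) : Finset ℕ :=
  Finset.Icc (2 + if i = 0 then 1 else 0) (2 * s - if i = q then 1 else 0)

theorem card_allowedTiers {s : ℕ} (hs : 2 ≤ s) (q i : ℕ) :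
    (allowedTiers s q i).card + cellLoss q i = 2 * s - 1 := by
  rw [allowedTiers, Nat.card_Icc, cellLoss]
  split_ifs <;> omega

namespace CellInv

variable {s : ℕ} {S : Finset (ℝ × ℕ)} {P : Finset ℝ}

theorem insert_pivot (h : CellInv s S P) {v : ℝ} (hv : v ∉ P) : CellInv s S (insert v P) where
  inj := h.inj
  tier := h.tier
  distinct p hp q hq hpq := by
    refine h.distinct p hp q hq ?_
    rw [cellIdx_insert hv, cellIdx_insert hv] at hpq
    split_ifs at hpq with h1 h2 h2
    · omega
    · have := cellIdx_mono P ((not_lt.1 h2).trans h1.le)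
      omega
    · have := cellIdx_mono P ((not_lt.1 h1).trans h2.le)
      omega
    · omega
  first p hp hi := by
    refine h.first p hp ?_
    rw [cellIdx_insert hv] at hi
    omega
  last p hp hi := by
    refine h.last p hp ?_
    rw [cellIdx_insert hv, Finset.card_insert_of_notMem hv] at hi
    have := cellIdx_le P p.1
    split_ifs at hi <;> omega

theorem cell_card_le (h : CellInv s S P) (hs : 2 ≤ s) (i : ℕ) :
    (cell S P i).card + cellLoss P.card i ≤ 2 * s - 1 := by
  rw [← card_allowedTiers hs P.card i]
  refine Nat.add_le_add_right (Finset.card_le_card_of_injOn Prod.snd ?_ ?_) _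
  · intro p hp
    obtain ⟨hp, hi⟩ := mem_cell.1 (Finset.mem_coe.1 hp)
    have h1 := h.tier p hp
    have h2 := h.first p hp
    have h3 := h.last p hp
    rw [hi] at h2 h3
    rw [Finset.mem_coe, allowedTiers, Finset.mem_Icc]
    grind
  · intro p hp q hq hpq
    obtain ⟨hp, hi⟩ := mem_cell.1 (Finset.mem_coe.1 hp)
    obtain ⟨hq, hi'⟩ := mem_cell.1 (Finset.mem_coe.1 hq)
    exact h.distinct p hp q hq (hi.trans hi'.symm) hpq

theorem exists_insert (h : CellInv s S P) (hs : 2 ≤ s) {x : ℝ} (hx : ∀ p ∈ S, p.1 ≠ x)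
    (hlt : (cell S P (cellIdx P x)).card + cellLoss P.card (cellIdx P x) < 2 * s - 1) :
    ∃ j, 2 ≤ j ∧ j ≤ 2 * s ∧ CellInv s (insert (x, j) S) P := by
  obtain ⟨j, hj, hj'⟩ : ∃ j ∈ allowedTiers s P.card (cellIdx P x),
      j ∉ (cell S P (cellIdx P x)).image Prod.snd := by
    refine Finset.exists_mem_notMem_of_card_lt_card (lt_of_le_of_lt Finset.card_image_le ?_)
    have := card_allowedTiers hs P.card (cellIdx P x)
    omega
  rw [allowedTiers, Finset.mem_Icc] at hj
  have hne : ∀ p ∈ S, cellIdx P p.1 = cellIdx P x → p.2 ≠ j := fun p hp hi hpj =>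
    hj' (Finset.mem_image.2 ⟨p, mem_cell.2 ⟨hp, hi⟩, hpj⟩)
  refine ⟨j, by omega, by omega, ?_, ?_, ?_, ?_, ?_⟩
  · rw [Finset.coe_insert, Set.injOn_insert fun hm => hx _ hm rfl]
    refine ⟨h.inj, ?_⟩
    rintro ⟨p, hp, hpx⟩
    exact hx p hp hpx
  · intro p hp
    rcases Finset.mem_insert.1 hp with rfl | hp
    · dsimp only
      omega
    · exact h.tier p hp
  · intro p hp q hq hi hpq
    rcases Finset.mem_insert.1 hp with rfl | hp <;> rcases Finset.mem_insert.1 hq with rfl | hq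
    · rfl
    · exact absurd hpq.symm (hne q hq hi.symm)
    · exact absurd hpq (hne p hp hi)
    · exact h.distinct p hp q hq hi hpq
  · intro p hp hi
    rcases Finset.mem_insert.1 hp with rfl | hp
    · rw [if_pos hi] at hj
      dsimp only
      omega
    · exact h.first p hp hi
  · intro p hp hi
    rcases Finset.mem_insert.1 hp with rfl | hp
    · have := hj.2
      rw [if_pos hi] at this
      dsimp only
      omega
    · exact h.last p hp hi

end CellInv

theorem exists_card_filter_le_eq (U : Finset ℝ) {c : ℕ} (hc : 1 ≤ c) (hcU : c ≤ U.card) :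
    ∃ v ∈ U, (U.filter fun y => y ≤ v).card = c := by
  induction U using Finset.induction_on_max with
  | empty => simp at hcU; omega
  | insert a U ha ih =>
    have haU : a ∉ U := fun h => lt_irrefl a (ha a h)
    rw [Finset.card_insert_of_notMem haU] at hcU
    rcases hcU.lt_or_eq with h | h
    · obtain ⟨v, hv, hvc⟩ := ih (by omega)
      refine ⟨v, Finset.mem_insert_of_mem hv, ?_⟩
      rw [Finset.filter_insert, if_neg (ha v hv).not_ge, hvc]
    · refine ⟨a, Finset.mem_insert_self _ _, ?_⟩
      rw [Finset.filter_true_of_mem, Finset.card_insert_of_notMem haU, h]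
      intro y hy
      rcases Finset.mem_insert.1 hy with rfl | hy
      · exact le_rfl
      · exact (ha y hy).le

theorem exists_card_filter_fst_le_eq {T : Finset (ℝ × ℕ)}
    (hT : Set.InjOn Prod.fst (T : Set (ℝ × ℕ))) {c : ℕ} (hc : 1 ≤ c) (hcT : c ≤ T.card) :
    ∃ p ∈ T, (T.filter fun q => q.1 ≤ p.1).card = c := by
  obtain ⟨v, hv, hvc⟩ := exists_card_filter_le_eq (T.image Prod.fst) hc
    (by rwa [Finset.card_image_of_injOn hT])
  obtain ⟨p, hp, rfl⟩ := Finset.mem_image.1 hv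
  refine ⟨p, hp, ?_⟩
  rw [Finset.filter_image, Finset.card_image_of_injOn
    (hT.mono (Finset.coe_subset.2 (Finset.filter_subset _ _)))] at hvc
  exact hvc

/-- A set of points can be split near a new abscissa `x` so that either `c` points are to the
left of the splitting place and `x` belongs to the left part, or `c + 1` points are to the left
and `x` belongs to the right part. -/
theorem exists_splitting {T : Finset (ℝ × ℕ)} (hT : Set.InjOn Prod.fst (T : Set (ℝ × ℕ)))
    {c : ℕ} (hcT : c < T.card) {x : ℝ} (hx : ∀ p ∈ T, p.1 ≠ x) :
    ∃ v, (v = x ∨ ∃ p ∈ T, p.1 = v) ∧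
      (x ≤ v ∧ (T.filter fun q => q.1 ≤ v).card = c ∨
        v < x ∧ (T.filter fun q => q.1 ≤ v).card = c + 1) := by
  have hlex : (T.filter fun q => q.1 < x) = T.filter fun q => q.1 ≤ x :=
    Finset.filter_congr fun q hq => (lt_iff_le_and_ne.trans (and_iff_left (hx q hq)))
  rcases lt_trichotomy c (T.filter fun q => q.1 < x).card with h | h | h
  · obtain ⟨p, hp, hpc⟩ := exists_card_filter_fst_le_eq
      (hT.mono (Finset.coe_subset.2 (Finset.filter_subset (fun q : ℝ × ℕ => q.1 < x) _)))
      (Nat.le_add_left 1 c) h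
    obtain ⟨hpT, hpx⟩ := Finset.mem_filter.1 hp
    refine ⟨p.1, Or.inr ⟨p, hpT, rfl⟩, Or.inr ⟨hpx, ?_⟩⟩
    rw [Finset.filter_filter] at hpc
    rw [← hpc]
    congr 1
    exact Finset.filter_congr fun q _ => ⟨fun hq => ⟨hq.trans_lt hpx, hq⟩, fun hq => hq.2⟩
  · exact ⟨x, Or.inl rfl, Or.inl ⟨le_rfl, by rw [← hlex, h]⟩⟩
  · obtain ⟨p, hp, hpc⟩ := exists_card_filter_fst_le_eq hT (c := c) (by omega) hcT.le
    refine ⟨p.1, Or.inr ⟨p, hp, rfl⟩, Or.inl ⟨?_, hpc⟩⟩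
    by_contra! hpx
    have : (T.filter fun q => q.1 ≤ p.1).card ≤ (T.filter fun q => q.1 < x).card :=
      Finset.card_le_card (Finset.monotone_filter_right _ fun q _ hq => lt_of_le_of_lt hq hpx)
    omega

/-- The position `S` has fewer than `R` pivots, and all cells are sufficiently filled as soon as
there is a pivot. -/
def InnerInv (s R : ℕ) (S : Finset (ℝ × ℕ)) : Prop :=
  ∃ P : Finset ℝ, P.card < R ∧ (∀ v ∈ P, ∃ p ∈ S, p.1 = v) ∧ CellInv s S P ∧
    (P.card ≠ 0 → ∀ i ≤ P.card, s ≤ (cell S P i).card + cellLoss P.card i)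

theorem sum_cellLoss {q : ℕ} : ∑ i ∈ Finset.range (q + 1), cellLoss q i = 2 := by
  simp [cellLoss, Finset.sum_add_distrib]

theorem sum_card_cell (S : Finset (ℝ × ℕ)) (P : Finset ℝ) :
    ∑ i ∈ Finset.range (P.card + 1), (cell S P i).card = S.card :=
  (Finset.card_eq_sum_card_fiberwise fun p _ =>
    Finset.mem_coe.2 (Finset.mem_range.2 (Nat.lt_succ_of_le (cellIdx_le P p.1)))).symm

/-- If all cells are sufficiently filled and one cell is full, there are many points. -/
theorem le_card_of_full_cell {s i : ℕ} {S : Finset (ℝ × ℕ)} {P : Finset ℝ} (hi : i ≤ P.card)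
    (hall : ∀ i ≤ P.card, s ≤ (cell S P i).card + cellLoss P.card i)
    (hfull : 2 * s - 1 ≤ (cell S P i).card + cellLoss P.card i) :
    s * P.card + (2 * s - 1) ≤ S.card + 2 := by
  have hmem : i ∈ Finset.range (P.card + 1) := Finset.mem_range.2 (by omega)
  have hsum : S.card + 2 = ∑ j ∈ Finset.range (P.card + 1),
      ((cell S P j).card + cellLoss P.card j) := by
    rw [Finset.sum_add_distrib, sum_card_cell, sum_cellLoss]
  rw [hsum, ← Finset.sum_erase_add _ _ hmem]
  refine Nat.add_le_add ?_ hfull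
  have := Finset.card_nsmul_le_sum ((Finset.range (P.card + 1)).erase i)
    (fun j => (cell S P j).card + cellLoss P.card j) s fun j hj =>
      hall j (Nat.le_of_lt_succ (Finset.mem_range.1 (Finset.mem_of_mem_erase hj)))
  rwa [Finset.card_erase_of_mem hmem, Finset.card_range, Nat.add_sub_cancel, smul_eq_mul,
    Nat.mul_comm] at this

theorem cell_card_mono {S S' : Finset (ℝ × ℕ)} (h : S ⊆ S') (P : Finset ℝ) (i : ℕ) :
    (cell S P i).card ≤ (cell S' P i).card :=
  Finset.card_le_card (Finset.filter_subset_filter _ h)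

theorem cell_insert_card {S : Finset (ℝ × ℕ)} {x : ℝ} (hx : ∀ p ∈ S, p.1 ≠ x) (j : ℕ)
    (P : Finset ℝ) :
    (cell (insert (x, j) S) P (cellIdx P x)).card = (cell S P (cellIdx P x)).card + 1 := by
  rw [cell, Finset.filter_insert, if_pos rfl, Finset.card_insert_of_notMem]
  · rfl
  · exact fun h => hx _ (Finset.mem_of_mem_filter _ h) rfl

theorem InnerInv.exists_insert {s R : ℕ} {S : Finset (ℝ × ℕ)} (h : InnerInv s R S) (hs : 2 ≤ s)
    (hR : 2 ≤ R) (hcard : S.card < s * (R + 1) - 3) {x : ℝ} (hx : ∀ p ∈ S, p.1 ≠ x) :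
    ∃ j, 2 ≤ j ∧ j ≤ 2 * s ∧ InnerInv s R (insert (x, j) S) := by
  obtain ⟨P, hPR, hPS, hP, hfill⟩ := h
  set i := cellIdx P x with hi
  have hiP : i ≤ P.card := cellIdx_le P x
  by_cases hlt : (cell S P i).card + cellLoss P.card i < 2 * s - 1
  · obtain ⟨j, hj2, hj, hP'⟩ := hP.exists_insert hs hx hlt
    refine ⟨j, hj2, hj, P, hPR, fun v hv => ?_, hP', fun h0 a ha => (hfill h0 a ha).trans ?_⟩
    · obtain ⟨p, hp, hpv⟩ := hPS v hv
      exact ⟨p, Finset.mem_insert_of_mem hp, hpv⟩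
    · exact Nat.add_le_add_right (cell_card_mono (Finset.subset_insert _ _) P a) _
  have hPR' : P.card + 1 < R := by
    by_contra hcon
    have hPc : P.card + 1 = R := by omega
    have := le_card_of_full_cell hiP (hfill (by omega)) (not_lt.1 hlt)
    rw [← hPc] at hcard
    have e : s * (P.card + 1 + 1) = s * P.card + 2 * s := by ring
    omega
  set c := s - 1 - if i = 0 then 1 else 0 with hc
  have hle := hP.cell_card_le hs i
  have hT : Set.InjOn Prod.fst (cell S P i : Set (ℝ × ℕ)) :=
    hP.inj.mono (Finset.coe_subset.2 (Finset.filter_subset _ _))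
  have hloss : cellLoss P.card i = (if i = 0 then 1 else 0) + if i = P.card then 1 else 0 := rfl
  have hcT : c < (cell S P i).card := by
    split_ifs at hc hloss <;> omega
  obtain ⟨v, hvS, hv⟩ := exists_splitting hT hcT (x := x) fun p hp => hx p (mem_cell.1 hp).1
  have hvi : cellIdx P v = i := by
    rcases hvS with rfl | ⟨p, hp, rfl⟩
    · rfl
    · exact (mem_cell.1 hp).2
  have hvP : v ∉ P := by
    intro hmem
    rcases hv with ⟨hxv, hvc⟩ | ⟨hvx, -⟩
    · have : ¬ ∀ p ∈ cell S P i, p.1 ≤ v := by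
        intro hall
        rw [Finset.filter_true_of_mem hall] at hvc
        omega
      push Not at this
      obtain ⟨p, hp, hvp⟩ := this
      have := cellIdx_lt_of_mem hmem hvp
      have := (mem_cell.1 hp).2
      omega
    · have := cellIdx_lt_of_mem hmem hvx
      omega
  have hP' := hP.insert_pivot hvP
  have hcardP := Finset.card_insert_of_notMem hvP
  have hleft := cell_insert_self S hvP
  have hright := cell_insert_self_add_one S hvP
  rw [hvi] at hleft hright
  have hsum : ((cell S P i).filter fun p => p.1 ≤ v).card +
      ((cell S P i).filter fun p => v < p.1).card = (cell S P i).card := by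
    simp only [← not_le]
    exact Finset.card_filter_add_card_filter_not _
  have hxi := cellIdx_insert hvP x
  rw [← hi] at hxi
  have hloss' (a : ℕ) : cellLoss (insert v P).card a =
      (if a = 0 then 1 else 0) + if a = P.card + 1 then 1 else 0 := by rw [hcardP]; rfl
  have hlossi := hloss' i
  have hlossi' := hloss' (i + 1)
  rw [← hleft, ← hright] at hsum
  rw [← hleft] at hv
  have hfree : (cell S (insert v P) (cellIdx (insert v P) x)).card +
      cellLoss (insert v P).card (cellIdx (insert v P) x) < 2 * s - 1 := by
    rcases hv with ⟨hxv, hvc⟩ | ⟨hvx, hvc⟩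
    · rw [if_neg hxv.not_gt, Nat.add_zero] at hxi
      rw [hxi, hvc]
      split_ifs at hc hlossi <;> omega
    · rw [if_pos hvx] at hxi
      rw [hxi]
      split_ifs at hc hlossi' hloss <;> omega
  obtain ⟨j, hj2, hj, hPj⟩ := hP'.exists_insert hs hx hfree
  refine ⟨j, hj2, hj, insert v P, by omega, ?_, hPj, fun _ a ha => ?_⟩
  · intro w hw
    rcases Finset.mem_insert.1 hw with rfl | hw
    · rcases hvS with rfl | ⟨p, hp, hpv⟩
      · exact ⟨_, Finset.mem_insert_self _ _, rfl⟩
      · exact ⟨p, Finset.mem_insert_of_mem (mem_cell.1 hp).1, hpv⟩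
    · obtain ⟨p, hp, hpw⟩ := hPS w hw
      exact ⟨p, Finset.mem_insert_of_mem hp, hpw⟩
  · have hmono := cell_card_mono (Finset.subset_insert (x, j) S) (insert v P) a
    have hinc := cell_insert_card hx j (insert v P)
    have hlossa := hloss' a
    have hlossb : cellLoss P.card a = (if a = 0 then 1 else 0) + if a = P.card then 1 else 0 := rfl
    rcases lt_trichotomy a i with hai | hai | hai
    · rw [cell_insert_of_lt S hvP (hvi ▸ hai)] at hmono
      have := hfill (by omega) a (by omega)
      split_ifs at hlossa hlossb <;> omega
    · subst hai
      rcases hv with ⟨hxv, hvc⟩ | ⟨hvx, hvc⟩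
      · rw [if_neg hxv.not_gt, Nat.add_zero] at hxi
        rw [hxi] at hinc
        split_ifs at hc hlossa <;> omega
      · split_ifs at hc hlossa <;> omega
    · rcases Nat.lt_or_ge (i + 1) a with hai' | hai'
      · obtain ⟨b, rfl⟩ : ∃ b, a = b + 1 := ⟨a - 1, by omega⟩
        rw [cell_insert_of_gt S hvP (j := b) (by omega)] at hmono
        have := hfill (by omega) b (by omega)
        have hlossc : cellLoss P.card b = (if b = 0 then 1 else 0) + if b = P.card then 1 else 0 :=
          rfl
        split_ifs at hlossa hlossc <;> omega
      · obtain rfl : a = i + 1 := by omega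
        rcases hv with ⟨hxv, hvc⟩ | ⟨hvx, hvc⟩
        · split_ifs at hc hlossa hloss <;> omega
        · rw [if_pos hvx] at hxi
          rw [hxi] at hinc
          split_ifs at hc hlossa hloss <;> omega

theorem InnerInv.empty {s R : ℕ} (hR : 1 ≤ R) : InnerInv s R ∅ := by
  refine ⟨∅, by rw [Finset.card_empty]; omega, by simp, ⟨?_, ?_, ?_, ?_, ?_⟩, by simp⟩ <;> simp

/-- After the inner phase, B survives `R - 3` more turns. -/
theorem InnerInv.survives {m k s R : ℕ} {S : Finset (ℝ × ℕ)} (h : InnerInv s R S) (hs : 2 ≤ s)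
    (hR : 3 ≤ R) (hm : R + 2 * s - 4 < m) (hk : 2 * s + 1 ≤ k - 1) : Survives m k (R - 3) S := by
  obtain ⟨P, hPR, -, hP, -⟩ := h
  refine survives_outer (n := 2 * s + 1) (lo := 3) (hi := R + 2 * s - 2)
    (fun z => cellIdx P z - 1) (fun z => R - 2 - cellIdx P z) (fun p => cellIdx P p.1 + p.2)
    (by omega) hk ?_ ?_ ?_ ?_ (by omega) ?_ ?_ ?_ ?_
  · intro p hp
    have := hP.tier p hp
    omega
  · exact fun x y hxy => Nat.sub_le_sub_right (cellIdx_mono P hxy) 1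
  · exact fun x y hxy => Nat.sub_le_sub_left (cellIdx_mono P hxy) _
  · intro x _
    have := cellIdx_le P x
    omega
  · intro x
    have := cellIdx_le P x
    omega
  · intro p hp
    have := hP.tier p hp
    have := hP.first p hp
    omega
  · intro p hp
    have := hP.tier p hp
    have := hP.last p hp
    have := cellIdx_le P p.1
    omega
  · intro p hp q hq hpq hle
    have h1 := cellIdx_mono P hpq.le
    have h2 := hP.distinct p hp q hq
    rcases h1.lt_or_eq with h1 | h1
    · omega
    · have : p.2 ≠ q.2 := fun h => hpq.ne (congrArg Prod.fst (h2 h1 h))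
      omega

theorem survives_many_tiers {m k s R : ℕ} (hs : 2 ≤ s) (hR : 3 ≤ R) (hm : R + 2 * s - 4 < m)
    (hk : 2 * s + 1 ≤ k - 1) : Survives m k (s * (R + 1) - 3 + (R - 3)) ∅ := by
  refine survives_of_invariant (InnerInv s R) ?_ (fun S hS _ => hS.survives hs hR hm hk) _ ∅
    (InnerInv.empty (by omega)) (by rw [Finset.card_empty, Nat.zero_add])
  intro S hS hlt x hx
  obtain ⟨j, h1, h2, h3⟩ := hS.exists_insert hs (by omega) hlt hx
  exact ⟨j, by omega, by omega, h3⟩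

theorem BNum_lower_odd (m k : ℕ) (hk : 5 ≤ k) (hko : Odd k) (hkm : k ≤ m) :
    (k - 1) / 2 * (m - k + 6) - 3 ≤ BNum m k := by
  obtain ⟨t, rfl⟩ := hko
  rw [Nat.add_sub_cancel, Nat.mul_div_cancel_left t two_pos]
  rcases (show 2 ≤ t by omega).lt_or_eq with ht | rfl
  · obtain ⟨s, rfl⟩ : ∃ s, t = s + 1 := ⟨t - 1, by omega⟩
    have := lt_BNum_of_survives (by omega) (survives_many_tiers (m := m) (k := 2 * (s + 1) + 1)
      (s := s) (R := m - (2 * (s + 1) + 1) + 6) (by omega) (by omega) (by omega) (by omega))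
    generalize hR : m - (2 * (s + 1) + 1) + 6 = R at this ⊢
    have e1 : s * (R + 1) = s * R + s := by ring
    have e2 : (s + 1) * R = s * R + R := by ring
    omega
  · obtain ⟨M, rfl⟩ : ∃ M, m = M + 1 := ⟨m - 1, by omega⟩
    have := lt_BNum_of_survives (by omega)
      (survives_three_tiers (k := 2 * 2 + 1) (M := M) (by omega) (by omega))
    omega
end

section
/- For every integer m ≥ 2, B(2,m) ≤ ⌊m/2⌋ + 1; that is, in the game B_{2,m}, player A has a strategy guaranteeing that, for every strategy of player B, among the first ⌊m/2⌋ + 1 points played there is a 2-up-run. -/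
open Set

/-- The state of the bisection strategy: the corners `(x, y)` of the left and the right end
of the active gap. -/
noncomputable def gapStep (s : Pt × Pt) (p : Pt) : Pt × Pt :=
  open Classical in if s.1.2 - p.2 ≤ p.2 - s.2.2 then (s.1, p) else (p, s.2)

/-- The active gap after the points of `h` have been played in the game with tiers below `m`. -/
noncomputable def activeGap (m : ℕ) (h : List Pt) : Pt × Pt :=
  h.foldl gapStep (((0 : ℝ), (m : ℝ)), ((1 : ℝ), (0 : ℝ)))

theorem activeGap_append_singleton (m : ℕ) (h : List Pt) (p : Pt) :
    activeGap m (h ++ [p]) = gapStep (activeGap m h) p := by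
  simp [activeGap]

theorem exists_fresh (h : List Pt) : ∃ x : ℝ, x ∈ Ioo (0 : ℝ) 1 ∧ ∀ p ∈ h, x ≠ p.1 := by
  obtain ⟨x, hx, hx'⟩ := ((Ioo_infinite (zero_lt_one' ℝ)).sdiff
    (h.map Prod.fst).finite_toSet).nonempty
  exact ⟨x, hx, fun p hp he => hx' (List.mem_map.2 ⟨p, hp, he.symm⟩)⟩

/-- Player A plays the midpoint of the active gap whenever that is a legal move. -/
noncomputable def bisectStrat (m : ℕ) : AStrat := fun h =>
  let x := ((activeGap m h).1.1 + (activeGap m h).2.1) / 2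
  open Classical in
  if x ∈ Ioo (0 : ℝ) 1 ∧ ∀ p ∈ h, x ≠ p.1 then x else (exists_fresh h).choose

theorem bisectStrat_valid (m : ℕ) : AValid (bisectStrat m) := by
  intro h
  unfold bisectStrat
  dsimp only
  split_ifs with hx
  · exact hx
  · exact (exists_fresh h).choose_spec

theorem hasUpRun_two {P : Set Pt} {p q : Pt} (hp : p ∈ P) (hq : q ∈ P)
    (hx : p.1 < q.1) (hy : p.2 ≤ q.2) : HasUpRun P 2 := by
  refine ⟨![p, q], ?_, ?_, ?_⟩
  · simp [Fin.forall_fin_two, hp, hq]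
  · rw [Fin.strictMono_iff_lt_succ]
    simpa using hx
  · rw [Fin.monotone_iff_le_succ]
    simpa using hy

theorem HasUpRun.mono {P Q : Set Pt} {n : ℕ} (hPQ : P ⊆ Q) (h : HasUpRun P n) :
    HasUpRun Q n := by
  obtain ⟨f, hf, h⟩ := h
  exact ⟨f, fun i => hPQ (hf i), h⟩

/-- The active gap `s` is free of points of `h`, its ends are played points or the initial
corners, and its height is an integer `d` with `d / 2 + n ≤ m / 2`. -/
structure GapInvariant (m n : ℕ) (h : List Pt) (s : Pt × Pt) : Prop where
  left_nonneg : 0 ≤ s.1.1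
  right_le_one : s.2.1 ≤ 1
  left_lt_right : s.1.1 < s.2.1
  free : ∀ p ∈ h, p.1 ≤ s.1.1 ∨ s.2.1 ≤ p.1
  left_mem : s.1.2 = m ∨ s.1 ∈ h
  right_mem : s.2.2 = 0 ∨ s.2 ∈ h
  height : ∃ a b : ℕ, s.1.2 = a ∧ s.2.2 = b ∧ b < a ∧ (a - b) / 2 + n ≤ m / 2

theorem GapInvariant.bisectStrat_eq {m n : ℕ} {h : List Pt}
    (H : GapInvariant m n h (activeGap m h)) :
    bisectStrat m h = ((activeGap m h).1.1 + (activeGap m h).2.1) / 2 := by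
  have h1 := H.left_nonneg
  have h2 := H.right_le_one
  have h3 := H.left_lt_right
  refine if_pos ⟨⟨by linarith, by linarith⟩, fun p hp he => ?_⟩
  rcases H.free p hp with h4 | h4 <;> linarith

theorem GapInvariant.step {m n : ℕ} {h : List Pt} {s : Pt × Pt} (H : GapInvariant m n h s)
    {p : Pt} (hl : s.1.1 < p.1) (hr : p.1 < s.2.1) {c : ℕ} (hc : p.2 = c)
    (hc1 : 1 ≤ c) (hcm : c ≤ m - 1) :
    HasUpRun {q | q ∈ h ++ [p]} 2 ∨ GapInvariant m (n + 1) (h ++ [p]) (gapStep s p) := by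
  obtain ⟨h0, h1, h2, hfree, hlm, hrm, a, b, ha, hb, hba, hn⟩ := H
  have hp : p ∈ h ++ [p] := by simp
  by_cases hca : a ≤ c
  · refine .inl ?_
    rcases hlm with hlm | hlm
    · have : a = m := by exact_mod_cast ha.symm.trans hlm
      omega
    · exact hasUpRun_two (List.mem_append_left _ hlm) hp hl (by rw [ha, hc]; exact_mod_cast hca)
  by_cases hcb : c ≤ b
  · refine .inl ?_
    rcases hrm with hrm | hrm
    · have : b = 0 := by exact_mod_cast hb.symm.trans hrm
      omega
    · exact hasUpRun_two hp (List.mem_append_left _ hrm) hr (by rw [hb, hc]; exact_mod_cast hcb)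
  refine .inr ?_
  unfold gapStep
  split_ifs with hs <;> rw [ha, hb, hc] at hs
  · have hs' : a + b ≤ c + c := by
      have : (a : ℝ) + b ≤ c + c := by linarith
      exact_mod_cast this
    refine ⟨h0, by linarith, hl, ?_, hlm.imp_right (List.mem_append_left _), .inr hp,
      a, c, ha, hc, by omega, by omega⟩
    intro q hq
    rcases List.mem_append.1 hq with hq | hq
    · exact (hfree q hq).imp_right fun h => hr.le.trans h
    · rw [List.mem_singleton.1 hq]
      exact .inr le_rfl
  · have hs' : c + c < a + b := by
      have : (c : ℝ) + c < a + b := by linarith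
      exact_mod_cast this
    refine ⟨by linarith, h1, hr, ?_, .inr hp, hrm.imp_right (List.mem_append_left _),
      c, b, hc, hb, by omega, by omega⟩
    intro q hq
    rcases List.mem_append.1 hq with hq | hq
    · exact (hfree q hq).imp_left fun h => h.trans hl.le
    · rw [List.mem_singleton.1 hq]
      exact .inl le_rfl

theorem hasUpRun_or_gapInvariant {m : ℕ} (hm : 2 ≤ m) {sB : BStrat} (hB : BTierValid m sB)
    (n : ℕ) : HasUpRun (played (bisectStrat m) sB n) 2 ∨
      GapInvariant m n (hist (bisectStrat m) sB n)
        (activeGap m (hist (bisectStrat m) sB n)) := by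
  induction n with
  | zero =>
    exact .inr ⟨le_rfl, le_rfl, zero_lt_one, by simp [hist], .inl rfl, .inl rfl,
      m, 0, rfl, Nat.cast_zero.symm, by omega, by omega⟩
  | succ n ih =>
    rcases ih with ih | ih
    · exact .inl (ih.mono fun p hp => List.mem_append_left _ hp)
    · obtain ⟨c, hc1, hcm, hc⟩ := hB (hist (bisectStrat m) sB n)
        (bisectStrat m (hist (bisectStrat m) sB n))
      have hx := ih.bisectStrat_eq
      have hlt := ih.left_lt_right
      have := ih.step (p := (bisectStrat m (hist (bisectStrat m) sB n), _))
        (by dsimp only; linarith) (by dsimp only; linarith) hc hc1 hcm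
      rwa [← activeGap_append_singleton] at this

theorem bisectStrat_wins {m : ℕ} (hm : 2 ≤ m) : AWinsTierBy 2 m (m / 2 + 1) (bisectStrat m) := by
  refine ⟨bisectStrat_valid m, fun sB hB => ?_⟩
  refine (hasUpRun_or_gapInvariant hm hB (m / 2 + 1)).resolve_right fun H => ?_
  obtain ⟨a, b, -, -, -, h⟩ := H.height
  omega

theorem BNum_two_m_upper (m : ℕ) (hm : 2 ≤ m) :
    BNum 2 m ≤ m / 2 + 1 ∧
    ∃ sA : AStrat, AWinsTierBy 2 m (m / 2 + 1) sA :=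
  ⟨Nat.sInf_le ⟨_, bisectStrat_wins hm⟩, _, bisectStrat_wins hm⟩
end

section
/- For all integers m, k ≥ 1, ESO(m,k) = ESO(k,m). -/
open Set

/-- Reflection of the plane in the line `y = 1/2`. -/
def reflectY (p : Pt) : Pt := (p.1, 1 - p.2)

theorem reflectY_reflectY (p : Pt) : reflectY (reflectY p) = p := by
  simp [reflectY]

theorem map_reflectY_map_reflectY (h : List Pt) :
    (h.map reflectY).map reflectY = h := by
  simp [Function.comp_def, reflectY_reflectY]

/-- The strategy of player A that plays `sA` in the reflected picture. -/
def AStrat.reflect (sA : AStrat) : AStrat := fun h => sA (h.map reflectY)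

/-- The strategy of player B that plays `sB` in the reflected picture. -/
def BStrat.reflect (sB : BStrat) : BStrat := fun h x => 1 - sB (h.map reflectY) x

theorem AValid.reflect {sA : AStrat} (hA : AValid sA) : AValid (AStrat.reflect sA) :=
  fun _ => ⟨(hA _).1, fun p hp => (hA _).2 (reflectY p) (List.mem_map_of_mem hp)⟩

theorem BValid.reflect {sB : BStrat} (hB : BValid sB) : BValid (BStrat.reflect sB) := by
  intro h x
  obtain ⟨⟨h0, h1⟩, hne⟩ := hB (h.map reflectY) x
  refine ⟨⟨by simp only [BStrat.reflect]; linarith, by simp only [BStrat.reflect]; linarith⟩,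
    fun p hp heq => hne (reflectY p) (List.mem_map_of_mem hp) ?_⟩
  simp only [BStrat.reflect] at heq
  simp only [reflectY]
  linarith

theorem hist_reflect (sA : AStrat) (sB : BStrat) (n : ℕ) :
    hist sA (BStrat.reflect sB) n = (hist (AStrat.reflect sA) sB n).map reflectY := by
  induction n with
  | zero => rfl
  | succ n ih =>
    simp only [hist, ih, List.map_append, List.map_cons, List.map_nil, BStrat.reflect,
      map_reflectY_map_reflectY, AStrat.reflect, reflectY]

theorem reflectY_mem_played {sA : AStrat} {sB : BStrat} {n : ℕ} {p : Pt}
    (hp : p ∈ played sA (BStrat.reflect sB) n) :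
    reflectY p ∈ played (AStrat.reflect sA) sB n := by
  simp only [played, mem_ofPred_eq, hist_reflect, List.mem_map] at hp ⊢
  obtain ⟨q, hq, rfl⟩ := hp
  rwa [reflectY_reflectY]

theorem injOn_snd_played (sA : AStrat) {sB : BStrat} (hB : BValid sB) (n : ℕ) :
    InjOn Prod.snd (played sA sB n) := by
  induction n with
  | zero => simp [InjOn, played, hist]
  | succ n ih =>
    intro p hp q hq hpq
    simp only [played, hist, mem_ofPred_eq, List.mem_append, List.mem_singleton] at hp hq
    have hne := (hB (hist sA sB n) (sA (hist sA sB n))).2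
    rcases hp with hp | rfl <;> rcases hq with hq | rfl
    · exact ih hp hq hpq
    · exact absurd hpq.symm (hne p hp)
    · exact absurd hpq (hne q hq)
    · rfl

theorem HasDownRun.reflect {P Q : Set Pt} {n : ℕ} (hPQ : ∀ p ∈ P, reflectY p ∈ Q)
    (hP : HasDownRun P n) : HasUpRun Q n := by
  obtain ⟨f, hf, hx, hy⟩ := hP
  exact ⟨fun i => reflectY (f i), fun i => hPQ _ (hf i), hx,
    fun i j hij => sub_le_sub_left (hy.antitone hij) 1⟩

theorem HasUpRun.reflect {P Q : Set Pt} {n : ℕ} (hPQ : ∀ p ∈ P, reflectY p ∈ Q)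
    (hinj : InjOn Prod.snd P) (hP : HasUpRun P n) : HasDownRun Q n := by
  obtain ⟨f, hf, hx, hy⟩ := hP
  refine ⟨fun i => reflectY (f i), fun i => hPQ _ (hf i), hx, fun i j hij => ?_⟩
  refine sub_lt_sub_left (lt_of_le_of_ne (hy hij.le) fun heq => ?_) 1
  exact (hx hij).ne (congrArg Prod.fst (hinj (hf i) (hf j) heq))

theorem AWinsBy.reflect {m k N : ℕ} {sA : AStrat} (h : AWinsBy m k N sA) :
    AWinsBy k m N (AStrat.reflect sA) := by
  refine ⟨h.1.reflect, fun sB hB => ?_⟩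
  rcases h.2 _ hB.reflect with hup | hdown
  · exact Or.inr (hup.reflect (fun _ => reflectY_mem_played) (injOn_snd_played _ hB.reflect N))
  · exact Or.inl (hdown.reflect fun _ => reflectY_mem_played)

theorem ESO_symm (m k : ℕ) (hm : 1 ≤ m) (hk : 1 ≤ k) :
    ESO m k = ESO k m := by
  unfold ESO
  congr 1
  ext N
  exact ⟨fun ⟨_, h⟩ => ⟨_, h.reflect⟩, fun ⟨_, h⟩ => ⟨_, h.reflect⟩⟩
end
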